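/- Let A > 0, B ≥ 0, B̄ ∈ ℝ, C ∈ ℝ, and define P(k) = C·∫₀¹ z^{k−1+B/A}·(1−z)^{(B̄−B)/A}·e^{(1/A)·1/(z−1)} dz for integers k ≥ 1. Then for every integer k with k − 1 + B/A > 0, P satisfies the recurrence (1 + 2A·k + B + B̄)·P(k) = (A(k−1)+B)·P(k−1) + (A(k+1)+B̄)·P(k+1). -/

import Mathlib

open intervalIntegral

open Filter Topology Set MeasureTheory

lemma tendsto_one_sub_rpow_mul_exp (b : ℝ) {c : ℝ} (hc : 0 < c) :
    Tendsto (fun z : ℝ => (1 - z) ^ b * Real.exp (c * (1 / (z - 1)))) (𝓝[<] 1) (𝓝 0) := by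
  have hsub : Tendsto (fun z : ℝ => 1 - z) (𝓝[<] 1) (𝓝[>] 0) := by
    refine tendsto_nhdsWithin_iff.2 ⟨?_, ?_⟩
    · have : Tendsto (fun z : ℝ => 1 - z) (𝓝 1) (𝓝 (1 - 1)) :=
        (continuous_const.sub continuous_id).tendsto 1
      rw [sub_self] at this
      exact this.mono_left nhdsWithin_le_nhds
    · filter_upwards [self_mem_nhdsWithin] with z hz
      exact sub_pos.2 (mem_Iio.1 hz)
  refine ((tendsto_rpow_mul_exp_neg_mul_atTop_nhds_zero (-b) c hc).comp
    (tendsto_inv_nhdsGT_zero.comp hsub)).congr' ?_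
  filter_upwards [self_mem_nhdsWithin] with z hz
  have hz' : 0 < 1 - z := sub_pos.2 (mem_Iio.1 hz)
  have hexp : c * (1 / (z - 1)) = -c * (1 - z)⁻¹ := by
    rw [← neg_sub 1 z, one_div, inv_neg]
    ring
  simp only [Function.comp_apply]
  rw [Real.inv_rpow hz'.le, Real.rpow_neg hz'.le, inv_inv, hexp]

lemma continuousOn_update_one_sub_rpow_mul_exp (b : ℝ) {c : ℝ} (hc : 0 < c) :
    ContinuousOn
      (Function.update (fun z : ℝ => (1 - z) ^ b * Real.exp (c * (1 / (z - 1)))) 1 0)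
      (Icc 0 1) := by
  rw [continuousOn_update_iff]
  refine ⟨fun z hz => ?_, fun _ => ?_⟩
  · have hz1 : z < 1 := lt_of_le_of_ne hz.1.2 hz.2
    have h1 : 1 - z ≠ 0 := by linarith
    have h2 : z - 1 ≠ 0 := by linarith
    refine ContinuousAt.continuousWithinAt ?_
    fun_prop (disch := first | assumption | exact Or.inl h1)
  · refine (tendsto_one_sub_rpow_mul_exp b hc).mono_left (nhdsWithin_mono _ fun z hz => ?_)
    exact lt_of_le_of_ne hz.1.2 hz.2

lemma intervalIntegrable_rpow_mul_one_sub_rpow_mul_exp {s : ℝ} (hs : -1 < s) (b : ℝ) {c : ℝ}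
    (hc : 0 < c) :
    IntervalIntegrable
      (fun z : ℝ => z ^ s * (1 - z) ^ b * Real.exp (c * (1 / (z - 1)))) volume 0 1 := by
  have h := (intervalIntegral.intervalIntegrable_rpow' (a := 0) (b := 1) hs).mul_continuousOn
    (g := Function.update (fun z : ℝ => (1 - z) ^ b * Real.exp (c * (1 / (z - 1)))) 1 0)
    (by rw [uIcc_of_le zero_le_one]; exact continuousOn_update_one_sub_rpow_mul_exp b hc)
  refine h.congr_ae (ae_restrict_of_ae ?_)
  filter_upwards [compl_mem_ae_iff.2 (measure_singleton (1 : ℝ))] with z hz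
  rw [Function.update_of_ne hz, mul_assoc]

lemma hasDerivAt_rpow_mul_one_sub_rpow_mul_exp (a b c : ℝ) {z : ℝ} (h0 : 0 < z) (h1 : z < 1) :
    HasDerivAt (fun z : ℝ => z ^ a * ((1 - z) ^ (b + 2) * Real.exp (c * (1 / (z - 1)))))
      (a * (z ^ (a - 1) * (1 - z) ^ b * Real.exp (c * (1 / (z - 1))))
        - (c + 2 * a + 2 + b) * (z ^ a * (1 - z) ^ b * Real.exp (c * (1 / (z - 1))))
        + (a + 2 + b) * (z ^ (a + 1) * (1 - z) ^ b * Real.exp (c * (1 / (z - 1))))) z := by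
  have hz : 0 < 1 - z := sub_pos.2 h1
  have hz' : z - 1 ≠ 0 := (sub_neg.2 h1).ne
  have hpow : HasDerivAt (fun z : ℝ => (1 - z) ^ (b + 2)) _ z :=
    ((hasDerivAt_id z).const_sub 1).rpow_const (p := b + 2) (Or.inl hz.ne')
  have hinv : HasDerivAt (fun z : ℝ => c * (1 / (z - 1))) (c * (-1 / (z - 1) ^ 2)) z := by
    simpa only [one_div, id_eq] using
      (((hasDerivAt_id z).sub_const 1).fun_inv hz').const_mul c
  refine ((Real.hasDerivAt_rpow_const (p := a) (Or.inl h0.ne')).mul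
    (hpow.mul hinv.exp)).congr_deriv ?_
  have e1 : z ^ a = z ^ (a - 1) * z := by
    rw [← Real.rpow_add_one h0.ne', sub_add_cancel]
  have e2 : z ^ (a + 1) = z ^ (a - 1) * z * z := by rw [Real.rpow_add_one h0.ne', e1]
  have e3 : (1 - z) ^ (b + 2) = (1 - z) ^ b * (1 - z) ^ 2 := by
    exact_mod_cast Real.rpow_add_natCast hz.ne' b 2
  have e4 : (1 - z) ^ (b + 2 - 1) = (1 - z) ^ b * (1 - z) := by
    rw [← Real.rpow_add_one hz.ne']
    congr 1
    ring
  simp only [Pi.mul_apply, id_eq, e1, e2, e3, e4]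
  field_simp
  ring

lemma integral_rpow_mul_one_sub_rpow_mul_exp_recurrence {a : ℝ} (ha : 0 < a) (b : ℝ) {c : ℝ}
    (hc : 0 < c) :
    (c + 2 * a + 2 + b)
        * ∫ z in (0 : ℝ)..1, z ^ a * (1 - z) ^ b * Real.exp (c * (1 / (z - 1)))
      = a * (∫ z in (0 : ℝ)..1, z ^ (a - 1) * (1 - z) ^ b * Real.exp (c * (1 / (z - 1))))
        + (a + 2 + b)
          * ∫ z in (0 : ℝ)..1, z ^ (a + 1) * (1 - z) ^ b * Real.exp (c * (1 / (z - 1))) := by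
  have i₁ := (intervalIntegrable_rpow_mul_one_sub_rpow_mul_exp
    (s := a - 1) (by linarith) b hc).const_mul a
  have i₂ := (intervalIntegrable_rpow_mul_one_sub_rpow_mul_exp
    (s := a) (by linarith) b hc).const_mul (c + 2 * a + 2 + b)
  have i₃ := (intervalIntegrable_rpow_mul_one_sub_rpow_mul_exp
    (s := a + 1) (by linarith) b hc).const_mul (a + 2 + b)
  have key := intervalIntegral.integral_eq_sub_of_hasDerivAt_of_le zero_le_one
    (f := fun z => z ^ a *
      Function.update (fun z : ℝ => (1 - z) ^ (b + 2) * Real.exp (c * (1 / (z - 1)))) 1 0 z)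
    ((Real.continuous_rpow_const ha.le).continuousOn.mul
      (continuousOn_update_one_sub_rpow_mul_exp (b + 2) hc))
    (fun z hz => (hasDerivAt_rpow_mul_one_sub_rpow_mul_exp a b c hz.1 hz.2).congr_of_eventuallyEq
      (by
        filter_upwards [isOpen_ne.mem_nhds hz.2.ne] with y hy
        rw [Function.update_of_ne hy]))
    ((i₁.sub i₂).add i₃)
  rw [intervalIntegral.integral_add (i₁.sub i₂) i₃, intervalIntegral.integral_sub i₁ i₂] at key
  simp only [intervalIntegral.integral_const_mul, Function.update_self, mul_zero,
    Real.zero_rpow ha.ne', zero_mul, sub_zero] at key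
  linarith

/-- case Ā = A ≠ 0: the integral formula
`P(k) = C ∫₀¹ z^{k−1+B/A} (1−z)^{(B̄−B)/A} e^{(1/A)·1/(z−1)} dz` satisfies the
steady-state recurrence `(1 + 2Ak + B + B̄) P(k) = (A(k−1)+B) P(k−1) + (A(k+1)+B̄) P(k+1)`
whenever `k − 1 + B/A > 0`. -/
theorem integral_solution_Abar_eq_A
    (A B Bbar C : ℝ) (hA : 0 < A) (hB : 0 ≤ B)
    (P : ℕ → ℝ)
    (hP : ∀ k : ℕ, P k
      = C * ∫ z in (0:ℝ)..1,
          z ^ ((k : ℝ) - 1 + B / A) * (1 - z) ^ ((Bbar - B) / A)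
            * Real.exp ((1 / A) * (1 / (z - 1)))) :
    ∀ k : ℕ, 1 ≤ k → 0 < (k : ℝ) - 1 + B / A →
      (1 + 2 * A * k + B + Bbar) * P k
        = (A * ((k : ℝ) - 1) + B) * P (k - 1)
          + (A * ((k : ℝ) + 1) + Bbar) * P (k + 1) := by
  intro k hk ha
  have hA' : A ≠ 0 := hA.ne'
  have key := integral_rpow_mul_one_sub_rpow_mul_exp_recurrence ha ((Bbar - B) / A)
    (one_div_pos.2 hA)
  rw [hP k, hP (k - 1), hP (k + 1), Nat.cast_sub hk, Nat.cast_add, Nat.cast_one,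
    show (k : ℝ) - 1 - 1 + B / A = (k : ℝ) - 1 + B / A - 1 by ring,
    show (k : ℝ) + 1 - 1 + B / A = (k : ℝ) - 1 + B / A + 1 by ring]
  have h₁ : 1 + 2 * A * k + B + Bbar
      = A * (1 / A + 2 * ((k : ℝ) - 1 + B / A) + 2 + (Bbar - B) / A) := by
    field_simp
    ring
  have h₂ : A * ((k : ℝ) - 1) + B = A * ((k : ℝ) - 1 + B / A) := by
    field_simp
  have h₃ : A * ((k : ℝ) + 1) + Bbar = A * ((k : ℝ) - 1 + B / A + 2 + (Bbar - B) / A) := by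
    field_simp
    ring
  rw [h₁, h₂, h₃]
  linear_combination A * C * key
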